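/- Let ℍ^+ = {(x, y, t) ∈ ℝ^{2n+1} : t > 0} and Q = 2n+2. There exists C > 0 such that for all u ∈ C_0^∞(ℍ^+): ( ∫_{ℍ^+} |∇_H u|² dξ − ∫_{ℍ^+} ((|x|² + |y|²)/t²) |u|² dξ )^{1/2} ≥ C ( ∫_{ℍ^+} |u|^{2Q/(Q−2)} dξ )^{(Q−2)/(2Q)}. -/

import Mathlib

open MeasureTheory Real

noncomputable section

abbrev H (n : ℕ) := (Fin n → ℝ) × (Fin n → ℝ) × ℝ

/-- Coefficient vector of the left-invariant field `X_i` at `ξ`. -/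
def Xv (n : ℕ) (i : Fin n) (ξ : H n) : H n := (Pi.single i 1, 0, 2 * ξ.2.1 i)

/-- Coefficient vector of the left-invariant field `Y_i` at `ξ`. -/
def Yv (n : ℕ) (i : Fin n) (ξ : H n) : H n := (0, Pi.single i 1, -(2 * ξ.1 i))

/-- The derivative `X_i f`. -/
def XD (n : ℕ) (i : Fin n) (f : H n → ℝ) (ξ : H n) : ℝ := fderiv ℝ f ξ (Xv n i ξ)

/-- The derivative `Y_i f`. -/
def YD (n : ℕ) (i : Fin n) (f : H n → ℝ) (ξ : H n) : ℝ := fderiv ℝ f ξ (Yv n i ξ)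

/-- Euclidean norm of the horizontal gradient. -/
def hNorm (n : ℕ) (f : H n → ℝ) (ξ : H n) : ℝ :=
  Real.sqrt (∑ i, ((XD n i f ξ) ^ 2 + (YD n i f ξ) ^ 2))

/-- Euclidean inner product on `ℝ^{2n+1}`. -/
def iprod (n : ℕ) (a b : H n) : ℝ :=
  (∑ i, a.1 i * b.1 i) + (∑ i, a.2.1 i * b.2.1 i) + a.2.2 * b.2.2


instance volume_isAddHaarMeasure (n : ℕ) : (volume : Measure (H n)).IsAddHaarMeasure :=
  Measure.prod.instIsAddHaarMeasure (volume : Measure (Fin n → ℝ))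
    (Measure.prod (volume : Measure (Fin n → ℝ)) (volume : Measure ℝ))

/-- The squared Euclidean norm `|x|² + |y|²` of the horizontal variables. -/
def radSq (n : ℕ) (ξ : H n) : ℝ := (∑ i, (ξ.1 i) ^ 2) + (∑ i, (ξ.2.1 i) ^ 2)

/-- The horizontal field `∑ i, (y_i X_i - x_i Y_i)`, which is half the horizontal gradient of `t`. -/
def rotField (n : ℕ) (ξ : H n) : H n := (ξ.2.1, -ξ.1, 2 * radSq n ξ)

lemma radSq_nonneg (n : ℕ) (ξ : H n) : 0 ≤ radSq n ξ := by
  unfold radSq; positivity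

lemma contDiff_radSq (n : ℕ) {k : WithTop ℕ∞} : ContDiff ℝ k (radSq n) := by
  unfold radSq; fun_prop

lemma clm_rotField (n : ℕ) (l : H n →L[ℝ] ℝ) (ξ : H n) :
    l (rotField n ξ) = ∑ i, (ξ.2.1 i * l (Xv n i ξ) - ξ.1 i * l (Yv n i ξ)) := by
  have h : rotField n ξ = ∑ i, (ξ.2.1 i • Xv n i ξ - ξ.1 i • Yv n i ξ) := by
    refine Prod.ext ?_ (Prod.ext ?_ ?_)
    · ext j
      simp [rotField, Xv, Yv, Prod.fst_sum, Finset.sum_apply, Pi.single_apply]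
    · ext j
      simp [rotField, Xv, Yv, Prod.fst_sum, Prod.snd_sum, Finset.sum_apply, Pi.single_apply]
    · simp only [rotField, Xv, Yv, radSq, Prod.snd_sum, Prod.smul_snd, Prod.snd_sub, smul_eq_mul,
        mul_add, Finset.mul_sum, ← Finset.sum_add_distrib]
      exact Finset.sum_congr rfl fun i _ => by ring
  rw [h, map_sum]
  simp

lemma rotField_eq_basis (n : ℕ) (ξ : H n) :
    rotField n ξ = (∑ i, (ξ.2.1 i • ((Pi.single i 1, 0, 0) : H n) +
      (-ξ.1 i) • ((0, Pi.single i 1, 0) : H n))) + (2 * radSq n ξ) • ((0, 0, 1) : H n) := by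
  refine Prod.ext ?_ (Prod.ext ?_ ?_)
  · ext j
    simp [rotField, Prod.fst_sum, Finset.sum_apply, Pi.single_apply]
  · ext j
    simp [rotField, Prod.fst_sum, Prod.snd_sum, Finset.sum_apply, Pi.single_apply]
  · simp [rotField, Prod.snd_sum]

lemma continuous_fderiv_apply_const {E : Type*} [NormedAddCommGroup E] [NormedSpace ℝ E]
    {G : E → ℝ} (hG : ContDiff ℝ 1 G) (e : E) : Continuous fun ξ => fderiv ℝ G ξ e :=
  (hG.continuous_fderiv one_ne_zero).clm_apply continuous_const

lemma integrable_mul_fderiv {n : ℕ} {f G : H n → ℝ} (hf : Continuous f)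
    (hG : ContDiff ℝ 1 G) (hGs : HasCompactSupport G) (e : H n) :
    Integrable fun ξ => f ξ * fderiv ℝ G ξ e :=
  (hf.mul (continuous_fderiv_apply_const hG e)).integrable_of_hasCompactSupport
    ((hGs.fderiv_apply ℝ e).mul_left)

lemma integral_mul_fderiv_eq_zero {n : ℕ} {f G : H n → ℝ} (hf : ContDiff ℝ 1 f)
    (hG : ContDiff ℝ 1 G) (hGs : HasCompactSupport G) (e : H n)
    (he : ∀ ξ, fderiv ℝ f ξ e = 0) : ∫ ξ, f ξ * fderiv ℝ G ξ e = 0 := by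
  rw [integral_mul_fderiv_eq_neg_fderiv_mul_of_integrable]
  · simp [he]
  · simp [he]
  · exact integrable_mul_fderiv hf.continuous hG hGs e
  · exact (hf.continuous.mul hG.continuous).integrable_of_hasCompactSupport hGs.mul_left
  · exact fun x _ => hf.differentiable one_ne_zero x
  · exact fun x _ => hG.differentiable one_ne_zero x

lemma fderiv_eq_zero_of_forall_add {n : ℕ} {f : H n → ℝ} (hf : ContDiff ℝ 1 f) {e : H n}
    (h : ∀ ξ (s : ℝ), f (ξ + s • e) = f ξ) (ξ : H n) : fderiv ℝ f ξ e = 0 := by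
  rw [← ((hf.differentiable one_ne_zero) ξ).lineDeriv_eq_fderiv]
  simp [lineDeriv, h]

/-- `rotField` is divergence free. -/
lemma integral_fderiv_rotField {n : ℕ} {G : H n → ℝ} (hG : ContDiff ℝ 1 G)
    (hGs : HasCompactSupport G) : ∫ ξ, fderiv ℝ G ξ (rotField n ξ) = 0 := by
  have hx (i : Fin n) : ContDiff ℝ 1 fun ξ : H n => -ξ.1 i := by fun_prop
  have hy (i : Fin n) : ContDiff ℝ 1 fun ξ : H n => ξ.2.1 i := by fun_prop
  have hr : ContDiff ℝ 1 fun ξ : H n => 2 * radSq n ξ :=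
    contDiff_const.mul (contDiff_radSq n)
  have key (ξ : H n) : fderiv ℝ G ξ (rotField n ξ) =
      (∑ i, (ξ.2.1 i * fderiv ℝ G ξ (Pi.single i 1, 0, 0) +
        (-ξ.1 i) * fderiv ℝ G ξ (0, Pi.single i 1, 0))) +
        (2 * radSq n ξ) * fderiv ℝ G ξ (0, 0, 1) := by
    rw [rotField_eq_basis, map_add, map_sum]
    simp only [map_add, map_smul, smul_eq_mul]
  simp only [key]
  have ix (i : Fin n) : Integrable fun ξ : H n =>
      (-ξ.1 i) * fderiv ℝ G ξ (0, Pi.single i 1, 0) := integrable_mul_fderiv (hx i).continuous hG hGs (0, Pi.single i 1, 0)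
  have iy (i : Fin n) : Integrable fun ξ : H n =>
      ξ.2.1 i * fderiv ℝ G ξ (Pi.single i 1, 0, 0) := integrable_mul_fderiv (hy i).continuous hG hGs (Pi.single i 1, 0, 0)
  have ixy (i : Fin n) : Integrable fun ξ : H n =>
      ξ.2.1 i * fderiv ℝ G ξ (Pi.single i 1, 0, 0) +
        (-ξ.1 i) * fderiv ℝ G ξ (0, Pi.single i 1, 0) := (iy i).add (ix i)
  rw [integral_add (integrable_finsetSum _ fun i _ => ixy i)
    (integrable_mul_fderiv hr.continuous hG hGs _), integral_finsetSum _ fun i _ => ixy i]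
  rw [integral_mul_fderiv_eq_zero hr hG hGs, add_zero]
  · refine Finset.sum_eq_zero fun i _ => ?_
    rw [integral_add (iy i) (ix i), integral_mul_fderiv_eq_zero (hy i) hG hGs,
      integral_mul_fderiv_eq_zero (hx i) hG hGs, add_zero]
    · exact fun ξ => fderiv_eq_zero_of_forall_add (hx i) (by simp) ξ
    · exact fun ξ => fderiv_eq_zero_of_forall_add (hy i) (by simp) ξ
  · exact fun ξ => fderiv_eq_zero_of_forall_add hr (by simp [radSq]) ξ

/-- Euclidean norm of `t ^ (1/2) ∇_H (t ^ (-1/2) u)`, the horizontal gradient of the ground state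
transform of `u`. -/
def groundNorm (n : ℕ) (u : H n → ℝ) (ξ : H n) : ℝ :=
  Real.sqrt (∑ i, ((XD n i u ξ - u ξ / ξ.2.2 * ξ.2.1 i) ^ 2 +
    (YD n i u ξ + u ξ / ξ.2.2 * ξ.1 i) ^ 2))

lemma hNorm_nonneg (n : ℕ) (u : H n → ℝ) (ξ : H n) : 0 ≤ hNorm n u ξ := Real.sqrt_nonneg _

lemma groundNorm_nonneg (n : ℕ) (u : H n → ℝ) (ξ : H n) : 0 ≤ groundNorm n u ξ :=
  Real.sqrt_nonneg _

lemma hNorm_sq (n : ℕ) (u : H n → ℝ) (ξ : H n) :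
    hNorm n u ξ ^ 2 = ∑ i, ((XD n i u ξ) ^ 2 + (YD n i u ξ) ^ 2) :=
  Real.sq_sqrt (by positivity)

lemma groundNorm_sq (n : ℕ) (u : H n → ℝ) (ξ : H n) :
    groundNorm n u ξ ^ 2 = hNorm n u ξ ^ 2 -
      2 * (u ξ / ξ.2.2) * fderiv ℝ u ξ (rotField n ξ) + (u ξ / ξ.2.2) ^ 2 * radSq n ξ := by
  rw [groundNorm, Real.sq_sqrt (by positivity), hNorm_sq, clm_rotField, radSq,
    ← Finset.sum_add_distrib, Finset.mul_sum, Finset.mul_sum, ← Finset.sum_sub_distrib,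
    ← Finset.sum_add_distrib]
  exact Finset.sum_congr rfl fun i _ => by simp only [XD, YD]; ring

lemma sum_rot_sq_le {n : ℕ} (x y a b : Fin n → ℝ) :
    (∑ i, (y i * a i - x i * b i)) ^ 2 ≤
      ((∑ i, x i ^ 2) + ∑ i, y i ^ 2) * ∑ i, (a i ^ 2 + b i ^ 2) := by
  have h := Finset.sum_mul_sq_le_sq_mul_sq (Finset.univ : Finset (Fin n ⊕ Fin n))
    (Sum.elim y (fun i => -x i)) (Sum.elim a b)
  simp only [Fintype.sum_sum_type, Sum.elim_inl, Sum.elim_inr, neg_mul, even_two, Even.neg_pow,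
    Finset.sum_neg_distrib, ← sub_eq_add_neg] at h
  rw [Finset.sum_sub_distrib, Finset.sum_add_distrib, add_comm (∑ i, x i ^ 2)]
  exact h

lemma abs_fderiv_rotField_sub_le (n : ℕ) (u : H n → ℝ) (ξ : H n) :
    |fderiv ℝ u ξ (rotField n ξ) - u ξ / ξ.2.2 * radSq n ξ| ≤
      Real.sqrt (radSq n ξ) * groundNorm n u ξ := by
  have h := sum_rot_sq_le ξ.1 ξ.2.1 (fun i => XD n i u ξ - u ξ / ξ.2.2 * ξ.2.1 i)
    (fun i => YD n i u ξ + u ξ / ξ.2.2 * ξ.1 i)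
  have e : fderiv ℝ u ξ (rotField n ξ) - u ξ / ξ.2.2 * radSq n ξ =
      ∑ i, (ξ.2.1 i * (XD n i u ξ - u ξ / ξ.2.2 * ξ.2.1 i) -
        ξ.1 i * (YD n i u ξ + u ξ / ξ.2.2 * ξ.1 i)) := by
    rw [clm_rotField, radSq, ← Finset.sum_add_distrib, Finset.mul_sum, ← Finset.sum_sub_distrib]
    exact Finset.sum_congr rfl fun i _ => by simp only [XD, YD]; ring
  rw [e, groundNorm, ← Real.sqrt_mul (radSq_nonneg n ξ)]
  exact Real.abs_le_sqrt h

lemma hNorm_le_groundNorm_add (n : ℕ) (u : H n → ℝ) (ξ : H n) :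
    hNorm n u ξ ≤ groundNorm n u ξ + |u ξ / ξ.2.2| * Real.sqrt (radSq n ξ) := by
  have h1 := groundNorm_sq n u ξ
  have h2 := abs_fderiv_rotField_sub_le n u ξ
  have hr := Real.sq_sqrt (radSq_nonneg n ξ)
  have hw := groundNorm_nonneg n u ξ
  have hs := Real.sqrt_nonneg (radSq n ξ)
  generalize fderiv ℝ u ξ (rotField n ξ) = T at *
  generalize u ξ / ξ.2.2 = k at *
  generalize Real.sqrt (radSq n ξ) = r at *
  refine abs_le_of_sq_le_sq' ?_ (by positivity) |>.2
  have h3 : k * (T - k * radSq n ξ) ≤ |k| * (r * groundNorm n u ξ) :=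
    (le_abs_self _).trans (by rw [abs_mul]; gcongr)
  nlinarith [sq_abs k]

lemma hNorm_comp {n : ℕ} {u : H n → ℝ} (F : ℝ → ℝ) {ξ : H n}
    (hF : DifferentiableAt ℝ F (u ξ)) (hu : DifferentiableAt ℝ u ξ) :
    hNorm n (fun ξ => F (u ξ)) ξ = |deriv F (u ξ)| * hNorm n u ξ := by
  have h : fderiv ℝ (fun ξ => F (u ξ)) ξ = deriv F (u ξ) • fderiv ℝ u ξ :=
    (hF.hasDerivAt.comp_hasFDerivAt ξ hu.hasFDerivAt).fderiv
  rw [hNorm, hNorm, ← Real.sqrt_sq_eq_abs, ← Real.sqrt_mul (sq_nonneg _), Finset.mul_sum]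
  congr 1
  exact Finset.sum_congr rfl fun i _ => by
    simp only [XD, YD, h, smul_apply, smul_eq_mul]; ring

/-- Chain rule estimate with the singular field `∇_H t / |∇_H t|` regularized at scale `δ`. -/
lemma hNorm_comp_le {n : ℕ} {u : H n → ℝ} (F : ℝ → ℝ) {ξ : H n}
    (hF : DifferentiableAt ℝ F (u ξ)) (hu : DifferentiableAt ℝ u ξ)
    (hpk : 0 ≤ deriv F (u ξ) * (u ξ / ξ.2.2)) {δ : ℝ} (hδ : 0 < δ) :
    hNorm n (fun ξ => F (u ξ)) ξ ≤ 2 * (|deriv F (u ξ)| * groundNorm n u ξ) +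
      (Real.sqrt (radSq n ξ + δ ^ 2))⁻¹ * (deriv F (u ξ) * fderiv ℝ u ξ (rotField n ξ)) +
      δ * (deriv F (u ξ) * (u ξ / ξ.2.2)) := by
  rw [hNorm_comp F hF hu]
  have h1 := hNorm_le_groundNorm_add n u ξ
  have h2 := abs_fderiv_rotField_sub_le n u ξ
  have hR := radSq_nonneg n ξ
  have hr := Real.sq_sqrt hR
  have hw := groundNorm_nonneg n u ξ
  have hs := Real.sqrt_nonneg (radSq n ξ)
  have hq : Real.sqrt (radSq n ξ) ≤ Real.sqrt (radSq n ξ + δ ^ 2) :=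
    Real.sqrt_le_sqrt (by nlinarith)
  have hq' : 0 < Real.sqrt (radSq n ξ + δ ^ 2) := Real.sqrt_pos.2 (by positivity)
  have hq2 : Real.sqrt (radSq n ξ + δ ^ 2) ≤ Real.sqrt (radSq n ξ) + δ := by
    rw [Real.sqrt_le_left (by positivity)]
    nlinarith
  generalize hNorm n u ξ = h at *
  generalize groundNorm n u ξ = w at *
  generalize fderiv ℝ u ξ (rotField n ξ) = T at *
  generalize u ξ / ξ.2.2 = k at *
  generalize Real.sqrt (radSq n ξ + δ ^ 2) = q at *
  generalize Real.sqrt (radSq n ξ) = r at *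
  generalize deriv F (u ξ) = p at *
  generalize radSq n ξ = R at *
  have a1 : r ≤ q⁻¹ * R + δ := by
    rw [← hr, inv_mul_eq_div, ← sub_le_iff_le_add, le_div_iff₀ hq']
    nlinarith
  have a2 : q⁻¹ * r ≤ 1 := by rw [inv_mul_eq_div]; exact (div_le_one hq').2 hq
  have a3 : q⁻¹ * (p * (k * R - T)) ≤ |p| * w := by
    calc q⁻¹ * (p * (k * R - T)) ≤ q⁻¹ * (|p| * (r * w)) := by
          refine mul_le_mul_of_nonneg_left ((le_abs_self _).trans ?_) (inv_nonneg.2 hq'.le)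
          rw [abs_mul, abs_sub_comm]
          gcongr
      _ = (q⁻¹ * r) * (|p| * w) := by ring
      _ ≤ 1 * (|p| * w) := by gcongr
      _ = _ := one_mul _
  have a4 : |p| * (|k| * r) ≤ p * k * (q⁻¹ * R + δ) := by
    rw [← mul_assoc, ← abs_mul, abs_of_nonneg hpk]
    gcongr
  have a5 : |p| * h ≤ |p| * (w + |k| * r) := by gcongr
  nlinarith

lemma contDiff_div_height {n : ℕ} {f : H n → ℝ} {k : WithTop ℕ∞} (hf : ContDiff ℝ k f)
    (ht : tsupport f ⊆ {ξ : H n | 0 < ξ.2.2}) : ContDiff ℝ k fun ξ => f ξ / ξ.2.2 := by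
  refine contDiff_iff_contDiffAt.2 fun ξ => ?_
  by_cases h : ξ ∈ tsupport f
  · exact hf.contDiffAt.div (by fun_prop) (ht h).ne'
  · refine (contDiffAt_const (c := (0 : ℝ))).congr_of_eventuallyEq ?_
    filter_upwards [notMem_tsupport_iff_eventuallyEq.1 h] with η hη
    simp [hη]

lemma continuous_hNorm {n : ℕ} {u : H n → ℝ} (hu : ContDiff ℝ 1 u) :
    Continuous (hNorm n u) := by
  have h := hu.continuous_fderiv one_ne_zero
  have hx (i : Fin n) : Continuous fun ξ => fderiv ℝ u ξ (Xv n i ξ) :=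
    h.clm_apply (by unfold Xv; fun_prop)
  have hy (i : Fin n) : Continuous fun ξ => fderiv ℝ u ξ (Yv n i ξ) :=
    h.clm_apply (by unfold Yv; fun_prop)
  unfold hNorm XD YD
  fun_prop

lemma continuous_groundNorm {n : ℕ} {u : H n → ℝ} (hu : ContDiff ℝ 1 u)
    (ht : tsupport u ⊆ {ξ : H n | 0 < ξ.2.2}) : Continuous (groundNorm n u) := by
  have h := hu.continuous_fderiv one_ne_zero
  have hx (i : Fin n) : Continuous fun ξ => fderiv ℝ u ξ (Xv n i ξ) :=
    h.clm_apply (by unfold Xv; fun_prop)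
  have hy (i : Fin n) : Continuous fun ξ => fderiv ℝ u ξ (Yv n i ξ) :=
    h.clm_apply (by unfold Yv; fun_prop)
  have hk : Continuous fun ξ => u ξ / ξ.2.2 := (contDiff_div_height hu ht).continuous
  unfold groundNorm XD YD
  fun_prop

lemma fderiv_eq_zero_of_notMem_tsupport {n : ℕ} {u : H n → ℝ} {ξ : H n} (h : ξ ∉ tsupport u) :
    fderiv ℝ u ξ = 0 :=
  Function.notMem_support.1 fun h' => h (support_fderiv_subset ℝ h')

lemma hNorm_eq_zero {n : ℕ} {u : H n → ℝ} {ξ : H n} (h : ξ ∉ tsupport u) :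
    hNorm n u ξ = 0 := by
  simp [hNorm, XD, YD, fderiv_eq_zero_of_notMem_tsupport h]

lemma groundNorm_eq_zero {n : ℕ} {u : H n → ℝ} {ξ : H n} (h : ξ ∉ tsupport u) :
    groundNorm n u ξ = 0 := by
  simp [groundNorm, XD, YD, fderiv_eq_zero_of_notMem_tsupport h, image_eq_zero_of_notMem_tsupport h]

lemma contDiff_rotField (n : ℕ) {k : WithTop ℕ∞} : ContDiff ℝ k (rotField n) := by
  unfold rotField
  exact (by fun_prop : ContDiff ℝ k fun ξ : H n => ξ.2.1).prodMk
    ((by fun_prop : ContDiff ℝ k fun ξ : H n => -ξ.1).prodMk (contDiff_const.mul (contDiff_radSq n)))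

/-- The ground state representation of the Hardy functional. -/
lemma integral_groundNorm_sq {n : ℕ} {u : H n → ℝ} (hu : ContDiff ℝ 1 u)
    (hc : HasCompactSupport u) (ht : tsupport u ⊆ {ξ : H n | 0 < ξ.2.2}) :
    ∫ ξ, groundNorm n u ξ ^ 2 =
      (∫ ξ, hNorm n u ξ ^ 2) - ∫ ξ, radSq n ξ / ξ.2.2 ^ 2 * |u ξ| ^ 2 := by
  have hk := contDiff_div_height hu ht
  have hG : ContDiff ℝ 1 fun ξ => u ξ * (u ξ / ξ.2.2) := hu.mul hk
  have hGc : HasCompactSupport fun ξ => u ξ * (u ξ / ξ.2.2) := hc.mul_right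
  have i1 : Integrable fun ξ => hNorm n u ξ ^ 2 :=
    ((continuous_hNorm hu).pow 2).integrable_of_hasCompactSupport
      (.intro hc fun ξ h => by simp [hNorm_eq_zero h])
  have i2 : Integrable fun ξ => radSq n ξ / ξ.2.2 ^ 2 * |u ξ| ^ 2 := by
    have : (fun ξ => radSq n ξ / ξ.2.2 ^ 2 * |u ξ| ^ 2) =
        fun ξ => radSq n ξ * (u ξ / ξ.2.2) ^ 2 := by
      ext ξ; rw [sq_abs]; ring
    rw [this]
    exact ((contDiff_radSq n (k := 1)).continuous.mul
      (hk.continuous.pow 2)).integrable_of_hasCompactSupport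
      (.intro hc fun ξ h => by simp [image_eq_zero_of_notMem_tsupport h])
  have i3 : Integrable fun ξ => fderiv ℝ (fun ξ => u ξ * (u ξ / ξ.2.2)) ξ (rotField n ξ) :=
    ((hG.continuous_fderiv one_ne_zero).clm_apply
      (contDiff_rotField n (k := 1)).continuous).integrable_of_hasCompactSupport
      (.intro hGc fun ξ h => by simp [fderiv_eq_zero_of_notMem_tsupport h])
  have key (ξ : H n) : groundNorm n u ξ ^ 2 = hNorm n u ξ ^ 2 -
      radSq n ξ / ξ.2.2 ^ 2 * |u ξ| ^ 2 -
      fderiv ℝ (fun ξ => u ξ * (u ξ / ξ.2.2)) ξ (rotField n ξ) := by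
    rw [groundNorm_sq]
    by_cases h : ξ ∈ tsupport u
    · have hpos : 0 < ξ.2.2 := ht h
      have ht' : HasFDerivAt (fun ξ : H n => ξ.2.2)
          ((ContinuousLinearMap.snd ℝ _ ℝ).comp (ContinuousLinearMap.snd ℝ (Fin n → ℝ) _)) ξ :=
        hasFDerivAt_snd.comp ξ hasFDerivAt_snd
      have hu' := (hu.differentiable one_ne_zero ξ).hasFDerivAt
      have hi := (hasDerivAt_inv hpos.ne').comp_hasFDerivAt ξ ht'
      have hd : HasFDerivAt (fun ξ => u ξ * (u ξ / ξ.2.2)) _ ξ := hu'.mul (hu'.mul hi)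
      rw [hd.fderiv, sq_abs]
      simp [rotField]
      field_simp
      ring
    · have h' : ξ ∉ tsupport fun ξ => u ξ * (u ξ / ξ.2.2) :=
        fun h'' => h (tsupport_mul_subset_left h'')
      simp [fderiv_eq_zero_of_notMem_tsupport h, fderiv_eq_zero_of_notMem_tsupport h',
        image_eq_zero_of_notMem_tsupport h]
  have i12 : Integrable fun ξ => hNorm n u ξ ^ 2 - radSq n ξ / ξ.2.2 ^ 2 * |u ξ| ^ 2 := i1.sub i2
  simp only [key]
  rw [integral_sub i12 i3, integral_sub i1 i2, integral_fderiv_rotField hG hGc, sub_zero]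

lemma integral_hNorm_comp_le {n : ℕ} {u : H n → ℝ} (hu : ContDiff ℝ 1 u)
    (hc : HasCompactSupport u) (ht : tsupport u ⊆ {ξ : H n | 0 < ξ.2.2}) {F : ℝ → ℝ}
    (hF : ContDiff ℝ 1 F) (hF0 : F 0 = 0) (hFs : ∀ s, 0 ≤ deriv F s * s) :
    ∫ ξ, hNorm n (fun ξ => F (u ξ)) ξ ≤ 2 * ∫ ξ, |deriv F (u ξ)| * groundNorm n u ξ := by
  have hF' : Continuous (deriv F) := hF.continuous_deriv le_rfl
  have hk := contDiff_div_height hu ht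
  have i1 : Integrable fun ξ => |deriv F (u ξ)| * groundNorm n u ξ :=
    ((hF'.comp hu.continuous).abs.mul (continuous_groundNorm hu ht)).integrable_of_hasCompactSupport
      (.intro hc fun ξ h => by simp [groundNorm_eq_zero h])
  have i3 : Integrable fun ξ => deriv F (u ξ) * (u ξ / ξ.2.2) :=
    ((hF'.comp hu.continuous).mul hk.continuous).integrable_of_hasCompactSupport
      (.intro hc fun ξ h => by simp [image_eq_zero_of_notMem_tsupport h])
  have main (δ : ℝ) (hδ : 0 < δ) : ∫ ξ, hNorm n (fun ξ => F (u ξ)) ξ ≤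
      2 * (∫ ξ, |deriv F (u ξ)| * groundNorm n u ξ) +
        δ * ∫ ξ, deriv F (u ξ) * (u ξ / ξ.2.2) := by
    have hpos (ξ : H n) : radSq n ξ + δ ^ 2 ≠ 0 := by
      have := radSq_nonneg n ξ
      positivity
    have hψ : ContDiff ℝ 1 fun ξ : H n => (Real.sqrt (radSq n ξ + δ ^ 2))⁻¹ :=
      (((contDiff_radSq n).add contDiff_const).sqrt hpos).inv fun ξ => by
        have := radSq_nonneg n ξ
        positivity
    have hψV (ξ : H n) :
        fderiv ℝ (fun ξ : H n => (Real.sqrt (radSq n ξ + δ ^ 2))⁻¹) ξ (rotField n ξ) = 0 := by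
      have hR : HasFDerivAt (radSq n) (fderiv ℝ (radSq n) ξ) ξ :=
        ((contDiff_radSq n (k := 1)).differentiable one_ne_zero ξ).hasFDerivAt
      have hRV : fderiv ℝ (radSq n) ξ (rotField n ξ) = 0 := by
        have hx (i : Fin n) : HasFDerivAt (fun ξ : H n => ξ.1 i ^ 2) ((2 * ξ.1 i) •
            (ContinuousLinearMap.proj i).comp (ContinuousLinearMap.fst ℝ (Fin n → ℝ) _)) ξ := by
          have h0 := (((ContinuousLinearMap.proj (R := ℝ) (φ := fun _ : Fin n => ℝ) i).comp
            (ContinuousLinearMap.fst ℝ (Fin n → ℝ) ((Fin n → ℝ) × ℝ))).hasFDerivAt (x := ξ)).pow 2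
          simpa using h0
        have hy (i : Fin n) : HasFDerivAt (fun ξ : H n => ξ.2.1 i ^ 2) ((2 * ξ.2.1 i) •
            (ContinuousLinearMap.proj i).comp ((ContinuousLinearMap.fst ℝ (Fin n → ℝ) ℝ).comp
              (ContinuousLinearMap.snd ℝ (Fin n → ℝ) _))) ξ := by
          have h0 := (((ContinuousLinearMap.proj (R := ℝ) (φ := fun _ : Fin n => ℝ) i).comp
            ((ContinuousLinearMap.fst ℝ (Fin n → ℝ) ℝ).comp
              (ContinuousLinearMap.snd ℝ (Fin n → ℝ) _))).hasFDerivAt (x := ξ)).pow 2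
          simpa using h0
        have h := (HasFDerivAt.fun_sum fun i (_ : i ∈ Finset.univ) => hx i).add
          (HasFDerivAt.fun_sum fun i (_ : i ∈ Finset.univ) => hy i)
        have h' : HasFDerivAt (radSq n) _ ξ := h
        rw [h'.fderiv]
        simp [rotField]
        rw [← Finset.sum_neg_distrib, ← Finset.sum_add_distrib]
        exact Finset.sum_eq_zero fun i _ => by ring
      have hs := ((hasDerivAt_id (radSq n ξ)).add_const (δ ^ 2)).sqrt (hpos ξ)
      have hi := hs.fun_inv (by have := radSq_nonneg n ξ; simp only [id]; positivity)
      have hcomp : HasFDerivAt (fun ξ : H n => (Real.sqrt (radSq n ξ + δ ^ 2))⁻¹) _ ξ :=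
        hi.comp_hasFDerivAt ξ hR
      rw [hcomp.fderiv]
      simp [hRV]
    have hFu : ContDiff ℝ 1 fun ξ => F (u ξ) := hF.comp hu
    have hG : ContDiff ℝ 1 fun ξ => (Real.sqrt (radSq n ξ + δ ^ 2))⁻¹ * F (u ξ) := hψ.mul hFu
    have hGc : HasCompactSupport fun ξ => (Real.sqrt (radSq n ξ + δ ^ 2))⁻¹ * F (u ξ) :=
      .intro hc fun ξ h => by simp [image_eq_zero_of_notMem_tsupport h, hF0]
    have hGV (ξ : H n) : fderiv ℝ (fun ξ => (Real.sqrt (radSq n ξ + δ ^ 2))⁻¹ * F (u ξ)) ξ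
        (rotField n ξ) = (Real.sqrt (radSq n ξ + δ ^ 2))⁻¹ *
          (deriv F (u ξ) * fderiv ℝ u ξ (rotField n ξ)) := by
      have h2 : HasFDerivAt (fun ξ => F (u ξ)) (deriv F (u ξ) • fderiv ℝ u ξ) ξ :=
        (hF.differentiable one_ne_zero _).hasDerivAt.comp_hasFDerivAt ξ
          (hu.differentiable one_ne_zero ξ).hasFDerivAt
      have h := (hψ.differentiable one_ne_zero ξ).hasFDerivAt.fun_mul h2
      rw [h.fderiv]
      simp [hψV]
    have i2 : Integrable fun ξ => (Real.sqrt (radSq n ξ + δ ^ 2))⁻¹ *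
          (deriv F (u ξ) * fderiv ℝ u ξ (rotField n ξ)) := by
      simp only [← hGV]
      exact ((hG.continuous_fderiv one_ne_zero).clm_apply
        (contDiff_rotField n (k := 1)).continuous).integrable_of_hasCompactSupport
        (.intro hGc fun ξ h => by simp [fderiv_eq_zero_of_notMem_tsupport h])
    have i2' := integral_fderiv_rotField hG hGc
    simp only [hGV] at i2'
    calc ∫ ξ, hNorm n (fun ξ => F (u ξ)) ξ
        ≤ ∫ ξ, (2 * (|deriv F (u ξ)| * groundNorm n u ξ) +
          (Real.sqrt (radSq n ξ + δ ^ 2))⁻¹ * (deriv F (u ξ) * fderiv ℝ u ξ (rotField n ξ)) +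
          δ * (deriv F (u ξ) * (u ξ / ξ.2.2))) := by
          refine integral_mono_of_nonneg (.of_forall fun ξ => hNorm_nonneg n _ ξ)
            (((i1.const_mul 2).add i2).add (i3.const_mul δ)) (.of_forall fun ξ => ?_)
          refine hNorm_comp_le F (hF.differentiable one_ne_zero _)
            (hu.differentiable one_ne_zero ξ) ?_ hδ
          by_cases h : ξ ∈ tsupport u
          · have hpos : 0 < ξ.2.2 := ht h
            rw [← mul_div_assoc]
            exact div_nonneg (hFs _) hpos.le
          · simp [image_eq_zero_of_notMem_tsupport h]
      _ = _ := by
          have i12 : Integrable fun ξ => 2 * (|deriv F (u ξ)| * groundNorm n u ξ) +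
              (Real.sqrt (radSq n ξ + δ ^ 2))⁻¹ *
                (deriv F (u ξ) * fderiv ℝ u ξ (rotField n ξ)) := (i1.const_mul 2).add i2
          rw [integral_add i12 (i3.const_mul δ),
            integral_add (i1.const_mul 2) i2, i2', integral_const_mul, integral_const_mul, add_zero]
  refine le_of_forall_pos_le_add fun ε hε => ?_
  set K := ∫ ξ, deriv F (u ξ) * (u ξ / ξ.2.2)
  refine (main (ε / (|K| + 1)) (by positivity)).trans ?_
  gcongr
  rw [div_mul_eq_mul_div, div_le_iff₀ (by positivity)]
  gcongr
  linarith [le_abs_self K]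

lemma integral_mul_le_sqrt_mul_sqrt {n : ℕ} {f g : H n → ℝ} (hf : Continuous f)
    (hfc : HasCompactSupport f) (hf0 : ∀ ξ, 0 ≤ f ξ) (hg : Continuous g)
    (hgc : HasCompactSupport g) (hg0 : ∀ ξ, 0 ≤ g ξ) :
    ∫ ξ, f ξ * g ξ ≤ (∫ ξ, f ξ ^ 2) ^ ((1 : ℝ) / 2) * (∫ ξ, g ξ ^ 2) ^ ((1 : ℝ) / 2) := by
  have h := integral_mul_le_Lp_mul_Lq_of_nonneg (μ := (volume : Measure (H n)))
    Real.HolderConjugate.two_two (.of_forall hf0) (.of_forall hg0)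
    (hf.memLp_of_hasCompactSupport hfc) (hg.memLp_of_hasCompactSupport hgc)
  simpa only [Real.rpow_two] using h

/-- Smooth approximation of `|s| ^ (2 * a)`. -/
def powApprox (a ε s : ℝ) : ℝ := (s ^ 2 + ε) ^ a - ε ^ a

lemma hasDerivAt_powApprox {a ε : ℝ} (hε : 0 < ε) (s : ℝ) :
    HasDerivAt (powApprox a ε) (2 * a * s * (s ^ 2 + ε) ^ (a - 1)) s := by
  have h := ((((hasDerivAt_id s).pow 2).add_const ε).rpow_const (p := a)
    (.inl (by simp only [Pi.pow_apply, id]; positivity))).sub_const (ε ^ a)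
  refine h.congr_deriv ?_
  simp only [Pi.pow_apply, id, Nat.cast_ofNat]
  ring

lemma contDiff_powApprox {a ε : ℝ} (hε : 0 < ε) {k : WithTop ℕ∞} :
    ContDiff ℝ k (powApprox a ε) := by
  unfold powApprox
  exact (ContDiff.rpow_const_of_ne (by fun_prop) fun s => by positivity).sub contDiff_const

lemma sobolev_le_groundNorm {n : ℕ} {c : ℝ} {u : H n → ℝ} {a q r : ℝ} (ha : 1 < a)
    (hq : 0 < q) (hr : 0 ≤ r)
    (hSob : ∀ g : H n → ℝ, ContDiff ℝ (⊤ : ℕ∞) g → HasCompactSupport g →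
      c * (∫ ξ : H n, |g ξ| ^ q) ^ r ≤ ∫ ξ : H n, hNorm n g ξ)
    (hu : ContDiff ℝ (⊤ : ℕ∞) u) (hc : HasCompactSupport u)
    (ht : tsupport u ⊆ {ξ : H n | 0 < ξ.2.2}) :
    c * (∫ ξ, |u ξ| ^ (2 * a * q)) ^ r ≤
      4 * a * ((∫ ξ, |u ξ| ^ (4 * a - 2)) ^ ((1 : ℝ) / 2) *
        (∫ ξ, groundNorm n u ξ ^ 2) ^ ((1 : ℝ) / 2)) := by
  have hu1 : ContDiff ℝ 1 u := hu.of_le (by exact_mod_cast le_top)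
  set D := ∫ ξ, groundNorm n u ξ ^ 2
  have hu0 {ξ : H n} (h : ξ ∉ tsupport u) : u ξ = 0 := image_eq_zero_of_notMem_tsupport h
  have pos (ε : ℝ) (hε : 0 < ε) :
      c * (∫ ξ in tsupport u, |powApprox a ε (u ξ)| ^ q) ^ r ≤
        2 * ((∫ ξ in tsupport u, (2 * a * u ξ * (u ξ ^ 2 + ε) ^ (a - 1)) ^ 2) ^ ((1 : ℝ) / 2) *
          D ^ ((1 : ℝ) / 2)) := by
    have hF0 : powApprox a ε 0 = 0 := by simp [powApprox]
    have hd (s : ℝ) := (hasDerivAt_powApprox (a := a) hε s).deriv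
    have hF1 : ContDiff ℝ 1 (powApprox a ε) := contDiff_powApprox hε
    rw [setIntegral_eq_integral_of_forall_compl_eq_zero fun ξ h => by
        simp [hu0 h, hF0, hq.ne'],
      setIntegral_eq_integral_of_forall_compl_eq_zero fun ξ h => by simp [hu0 h]]
    have h1 := hSob (fun ξ => powApprox a ε (u ξ)) ((contDiff_powApprox hε).comp hu)
      (.intro hc fun ξ h => by simp [hu0 h, hF0])
    have h2 := integral_hNorm_comp_le hu1 hc ht hF1 hF0 fun s => by
      rw [hd, show 2 * a * s * (s ^ 2 + ε) ^ (a - 1) * s =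
        2 * a * s ^ 2 * (s ^ 2 + ε) ^ (a - 1) by ring]
      positivity
    have h3 := integral_mul_le_sqrt_mul_sqrt (n := n)
      (f := fun ξ => |deriv (powApprox a ε) (u ξ)|) (g := groundNorm n u)
      ((hF1.continuous_deriv le_rfl).comp hu.continuous).abs
      (.intro hc fun ξ h => by simp [hu0 h, hd]) (fun _ => abs_nonneg _)
      (continuous_groundNorm hu1 ht) (.intro hc fun ξ h => groundNorm_eq_zero h)
      (groundNorm_nonneg n u)
    simp only [sq_abs, hd] at h3
    simp only [hd] at h2
    linarith
  have hcu : Continuous fun p : ℝ × H n => u p.2 := hu.continuous.comp continuous_snd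
  have c1 : Continuous fun ε : ℝ =>
      c * (∫ ξ in tsupport u, |powApprox a ε (u ξ)| ^ q) ^ r := by
    refine continuous_const.mul (Continuous.rpow_const ?_ fun _ => .inr hr)
    refine continuous_parametric_integral_of_continuous ?_ hc
    refine Continuous.rpow_const (Continuous.abs ?_) fun _ => .inr hq.le
    exact (((hcu.pow 2).add continuous_fst).rpow_const fun _ => .inr (by linarith)).sub
      (continuous_fst.rpow_const fun _ => .inr (by linarith))
  have c2 : Continuous fun ε : ℝ =>
      2 * ((∫ ξ in tsupport u, (2 * a * u ξ * (u ξ ^ 2 + ε) ^ (a - 1)) ^ 2) ^ ((1 : ℝ) / 2) *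
          D ^ ((1 : ℝ) / 2)) := by
    refine continuous_const.mul ((Continuous.rpow_const ?_ fun _ => .inr (by norm_num)).mul
      continuous_const)
    refine continuous_parametric_integral_of_continuous ?_ hc
    exact ((continuous_const.mul hcu).mul (((hcu.pow 2).add continuous_fst).rpow_const
      fun _ => .inr (by linarith))).pow 2
  have lim := ContinuousWithinAt.closure_le (s := Set.Ioi (0 : ℝ)) (x := 0) (by simp)
    c1.continuousWithinAt c2.continuousWithinAt pos
  have e1 (ξ : H n) : |powApprox a 0 (u ξ)| ^ q = |u ξ| ^ (2 * a * q) := by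
    rw [powApprox, add_zero, Real.zero_rpow (by linarith), sub_zero, ← sq_abs (u ξ),
      ← Real.rpow_natCast, ← Real.rpow_mul (abs_nonneg _), abs_of_nonneg (by positivity),
      ← Real.rpow_mul (abs_nonneg _), Nat.cast_ofNat]
  have e2 (ξ : H n) : (2 * a * u ξ * (u ξ ^ 2 + 0) ^ (a - 1)) ^ 2 =
      (2 * a) ^ 2 * |u ξ| ^ (4 * a - 2) := by
    rw [add_zero, mul_pow, mul_pow, mul_assoc]
    congr 1
    rw [← sq_abs (u ξ)]
    rcases (abs_nonneg (u ξ)).eq_or_lt with h | h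
    · rw [← h, Real.zero_rpow (by linarith)]
      simp
    · rw [← Real.rpow_natCast |u ξ|, ← Real.rpow_natCast (_ ^ (a - 1)), ← Real.rpow_mul h.le,
        ← Real.rpow_mul h.le, ← Real.rpow_add h]
      congr 1
      push_cast
      ring
  simp only [e1, e2] at lim
  rw [setIntegral_eq_integral_of_forall_compl_eq_zero fun ξ h => by
      rw [hu0 h, abs_zero, Real.zero_rpow (by positivity)],
    setIntegral_eq_integral_of_forall_compl_eq_zero fun ξ h => by
      rw [hu0 h, abs_zero, Real.zero_rpow (by linarith), mul_zero],
    integral_const_mul, Real.mul_rpow (by positivity)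
      (integral_nonneg fun ξ => by positivity), ← Real.sqrt_eq_rpow ((2 * a) ^ 2),
    Real.sqrt_sq (by linarith)] at lim
  linarith

lemma not_sobolev_zero {c q r : ℝ} (hc : 0 < c) (hq : 0 < q)
    (hSob : ∀ g : H 0 → ℝ, ContDiff ℝ (⊤ : ℕ∞) g → HasCompactSupport g →
      c * (∫ ξ : H 0, |g ξ| ^ q) ^ r ≤ ∫ ξ : H 0, hNorm 0 g ξ) : False := by
  let b : ContDiffBump (0 : H 0) := ⟨1, 2, one_pos, one_lt_two⟩
  have h := hSob b b.contDiff b.hasCompactSupport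
  have hpos : 0 < ∫ ξ, |b ξ| ^ q := by
    refine Continuous.integral_pos_of_hasCompactSupport_nonneg_nonzero (x := 0)
      (b.continuous.abs.rpow_const fun _ => .inr hq.le)
      (.intro b.hasCompactSupport fun ξ h => ?_) (fun ξ => by positivity) ?_
    · simp [image_eq_zero_of_notMem_tsupport h, hq.ne']
    · rw [b.one_of_mem_closedBall, abs_one, Real.one_rpow]
      · exact one_ne_zero
      · simp [b]
  have h0 : ∫ ξ : H 0, hNorm 0 b ξ = 0 := by simp [hNorm]
  rw [h0] at h
  exact absurd h (not_le.2 (by positivity))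

theorem hardy_sobolev_mazya (n : ℕ)
    (c : ℝ) (hc : 0 < c)
    (hSob : ∀ g : H n → ℝ, ContDiff ℝ (⊤ : ℕ∞) g → HasCompactSupport g →
      c * (∫ ξ : H n, |g ξ| ^ ((2 * n + 2 : ℝ) / (2 * n + 1 : ℝ))) ^
            ((2 * n + 1 : ℝ) / (2 * n + 2 : ℝ)) ≤
        ∫ ξ : H n, hNorm n g ξ) :
    ∃ C > 0, ∀ u : H n → ℝ, ContDiff ℝ (⊤ : ℕ∞) u → HasCompactSupport u →
      tsupport u ⊆ {ξ : H n | 0 < ξ.2.2} →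
      ((∫ ξ in {ξ : H n | 0 < ξ.2.2}, hNorm n u ξ ^ 2) -
          ∫ ξ in {ξ : H n | 0 < ξ.2.2},
            ((∑ i, (ξ.1 i) ^ 2) + (∑ i, (ξ.2.1 i) ^ 2)) / ξ.2.2 ^ 2 * |u ξ| ^ 2) ^
          ((1 : ℝ) / 2) ≥
        C * (∫ ξ in {ξ : H n | 0 < ξ.2.2},
              |u ξ| ^ ((2 * (2 * n + 2 : ℝ)) / ((2 * n + 2 : ℝ) - 2))) ^
            (((2 * n + 2 : ℝ) - 2) / (2 * (2 * n + 2 : ℝ))) := by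
  rcases n.eq_zero_or_pos with rfl | hn
  · exact (not_sobolev_zero hc (by norm_num) hSob).elim
  have hN : (0 : ℝ) < n := by exact_mod_cast hn
  set a : ℝ := (2 * n + 1) / (2 * n) with ha
  have ha1 : 1 < a := by rw [ha, lt_div_iff₀ (by positivity)]; linarith
  refine ⟨c / (4 * a), by positivity, fun u hu huc ht => ?_⟩
  have hu0 {ξ : H n} (h : ξ ∉ {ξ : H n | 0 < ξ.2.2}) : ξ ∉ tsupport u := fun h' => h (ht h')
  have hu0' {ξ : H n} (h : ξ ∉ {ξ : H n | 0 < ξ.2.2}) : u ξ = 0 :=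
    image_eq_zero_of_notMem_tsupport (hu0 h)
  have hP : (2 * (2 * n + 2 : ℝ)) / ((2 * n + 2 : ℝ) - 2) ≠ 0 := by
    rw [add_sub_cancel_right]; positivity
  rw [setIntegral_eq_integral_of_forall_compl_eq_zero fun ξ h => by simp [hNorm_eq_zero (hu0 h)],
    setIntegral_eq_integral_of_forall_compl_eq_zero fun ξ h => by simp [hu0' h],
    setIntegral_eq_integral_of_forall_compl_eq_zero fun ξ h => by
      rw [hu0' h, abs_zero, Real.zero_rpow hP]]
  have hD := integral_groundNorm_sq (hu.of_le (by exact_mod_cast le_top)) huc ht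
  simp only [radSq] at hD
  rw [← hD]
  have key := sobolev_le_groundNorm ha1 (by positivity) (by positivity) hSob hu huc ht
  have e1 : 2 * a * ((2 * n + 2 : ℝ) / (2 * n + 1)) =
      (2 * (2 * n + 2 : ℝ)) / ((2 * n + 2 : ℝ) - 2) := by
    rw [ha, add_sub_cancel_right]; field_simp
  have e2 : 4 * a - 2 = (2 * (2 * n + 2 : ℝ)) / ((2 * n + 2 : ℝ) - 2) := by
    rw [ha, add_sub_cancel_right]; field_simp; ring
  rw [e1, e2] at key
  have hI0 : 0 ≤ ∫ ξ, |u ξ| ^ ((2 * (2 * n + 2 : ℝ)) / ((2 * n + 2 : ℝ) - 2)) :=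
    integral_nonneg fun ξ => by positivity
  have hD0 : 0 ≤ ∫ ξ, groundNorm n u ξ ^ 2 := integral_nonneg fun ξ => by positivity
  generalize (∫ ξ, |u ξ| ^ ((2 * (2 * n + 2 : ℝ)) / ((2 * n + 2 : ℝ) - 2))) = I at *
  generalize (∫ ξ, groundNorm n u ξ ^ 2) = D at *
  rcases hI0.eq_or_lt with rfl | hI
  · rw [Real.zero_rpow (by rw [add_sub_cancel_right]; positivity), mul_zero]
    positivity
  · have e3 : (2 * n + 1 : ℝ) / (2 * n + 2) =
        1 / 2 + ((2 * n + 2 : ℝ) - 2) / (2 * (2 * n + 2 : ℝ)) := by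
      field_simp; ring
    rw [e3, Real.rpow_add hI] at key
    have hI2 : 0 < I ^ ((1 : ℝ) / 2) := by positivity
    rw [ge_iff_le, div_mul_eq_mul_div, div_le_iff₀ (by positivity)]
    refine le_of_mul_le_mul_left ?_ hI2
    linarith
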